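/- arXiv:0911.5017 — 4 statements merged into one kernel-verified Lean document; each statement's English description precedes it below -/
import Mathlib

section
/- Let u, v, x, y be points in the Euclidean plane with u ≠ v, and suppose that dist(x,u) − dist(x,v) = dist(y,u) − dist(y,v) (i.e., x and y lie on the same locus of constant difference of distances to the foci u and v). If u and v lie strictly on the same side of the affine span of {x, y} (in the sense of AffineSubspace.SSameSide), then the closed segment [x, y] contains a point of the line through u and v (the affine span of {u, v}). -/
open scoped RealInnerProductSpace

/-- Signed (double) area of the triangle `a b c`. -/
def crossArea (a b c : EuclideanSpace ℝ (Fin 2)) : ℝ :=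
  (b 0 - a 0) * (c 1 - a 1) - (b 1 - a 1) * (c 0 - a 0)

lemma mem_line_of_crossArea (a b c : EuclideanSpace ℝ (Fin 2)) (hab : a ≠ b)
    (h : crossArea a b c = 0) : c ∈ affineSpan ℝ ({a, b} : Set (EuclideanSpace ℝ (Fin 2))) := by
  have hN : (b 0 - a 0) ^ 2 + (b 1 - a 1) ^ 2 ≠ 0 := by
    intro h0
    apply hab
    ext i
    fin_cases i <;> simp <;> nlinarith [sq_nonneg (b 0 - a 0), sq_nonneg (b 1 - a 1)]
  unfold crossArea at h
  have key : c = AffineMap.lineMap a b (((b 0 - a 0) * (c 0 - a 0) + (b 1 - a 1) * (c 1 - a 1)) /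
      ((b 0 - a 0) ^ 2 + (b 1 - a 1) ^ 2)) := by
    ext i
    fin_cases i
    · simp [AffineMap.lineMap_apply]
      field_simp
      linear_combination (-(b 1 - a 1)) * h
    · simp [AffineMap.lineMap_apply]
      field_simp
      linear_combination (b 0 - a 0) * h
  rw [key]
  exact AffineMap.lineMap_mem_affineSpan_pair _ _ _

lemma dist_lt_of_cross (u v x y : EuclideanSpace ℝ (Fin 2)) (α β γ δ : ℝ)
    (hα : 0 < α) (hβ : 0 < β) (hγ : 0 < γ) (hδ : 0 < δ) (hs : α + β = γ + δ)
    (h0 : α * x 0 + β * u 0 = γ * y 0 + δ * v 0)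
    (h1 : α * x 1 + β * u 1 = γ * y 1 + δ * v 1)
    (hS : crossArea x u v ≠ 0) :
    dist x v + dist y u < dist x u + dist y v := by
  have hp : 0 < α + β := by positivity
  set w := AffineMap.lineMap x u (β / (α + β)) with hw
  have hw' : w = AffineMap.lineMap y v (δ / (α + β)) := by
    rw [hw]
    ext i
    fin_cases i
    · simp [AffineMap.lineMap_apply]
      field_simp
      linear_combination h0 - y 0 * hs
    · simp [AffineMap.lineMap_apply]
      field_simp
      linear_combination h1 - y 1 * hs
  have b1 : Wbtw ℝ x w u :=
    ⟨_, ⟨by positivity, by rw [div_le_one hp]; linarith⟩, hw.symm⟩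
  have b2 : Wbtw ℝ y w v :=
    ⟨_, ⟨by positivity, by rw [div_le_one hp]; linarith⟩, hw'.symm⟩
  have e1 := b1.dist_add_dist
  have e2 := b2.dist_add_dist
  have t1 := dist_triangle x w v
  have t2 := dist_triangle y w u
  by_contra hcon
  have e3 : dist x w + dist w v = dist x v := by linarith
  obtain ⟨s, -, hs'⟩ := dist_add_dist_eq_iff.1 e3
  apply hS
  rw [hw] at hs'
  have c0 := congrArg (fun p : EuclideanSpace ℝ (Fin 2) => p 0) hs'
  have c1 := congrArg (fun p : EuclideanSpace ℝ (Fin 2) => p 1) hs'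
  simp [AffineMap.lineMap_apply] at c0 c1
  have ht : β / (α + β) ≠ 0 := by positivity
  apply mul_left_cancel₀ ht
  unfold crossArea
  linear_combination (-(v 1 - x 1)) * c0 + (v 0 - x 0) * c1

/-- If `x` and `y` lie on the same branch-type locus of constant difference of distances to
the foci `u ≠ v`, and `u`, `v` lie strictly on the same side of the line through `x` and `y`,
then the closed segment `[x, y]` meets the line through `u` and `v`. -/
theorem segment_meets_focal_line_of_constant_dist_diff
    (u v x y : EuclideanSpace ℝ (Fin 2)) (huv : u ≠ v)
    (hdiff : dist x u - dist x v = dist y u - dist y v)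
    (hside : AffineSubspace.SSameSide (affineSpan ℝ ({x, y} : Set (EuclideanSpace ℝ (Fin 2)))) u v) :
    ∃ z ∈ segment ℝ x y, z ∈ (affineSpan ℝ ({u, v} : Set (EuclideanSpace ℝ (Fin 2))) : Set (EuclideanSpace ℝ (Fin 2))) := by
  obtain ⟨⟨p, hp, q, hq, hray⟩, hu, hv⟩ := hside
  by_cases hx : crossArea u v x = 0
  · exact ⟨x, left_mem_segment ℝ x y, mem_line_of_crossArea u v x huv hx⟩
  by_cases hy : crossArea u v y = 0
  · exact ⟨y, right_mem_segment ℝ x y, mem_line_of_crossArea u v y huv hy⟩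
  obtain ⟨s, rfl⟩ := mem_affineSpan_pair_iff_exists_lineMap_eq.1 hp
  obtain ⟨t, rfl⟩ := mem_affineSpan_pair_iff_exists_lineMap_eq.1 hq
  rcases hray with h | h | ⟨r₁, r₂, hr₁, hr₂, h⟩
  · rw [vsub_eq_zero_iff_eq] at h
    exact absurd (h ▸ hp) hu
  · rw [vsub_eq_zero_iff_eq] at h
    exact absurd (h ▸ hq) hv
  have c0 := congrArg (fun p : EuclideanSpace ℝ (Fin 2) => p 0) h
  have c1 := congrArg (fun p : EuclideanSpace ℝ (Fin 2) => p 1) h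
  simp [AffineMap.lineMap_apply] at c0 c1
  by_cases hxy : x = y
  · subst hxy
    exfalso
    apply hx
    simp at c0 c1
    apply mul_left_cancel₀ hr₁.ne'
    unfold crossArea
    linear_combination (v 1 - x 1) * c0 - (v 0 - x 0) * c1
  have hT : r₁ * crossArea x y u = r₂ * crossArea x y v := by
    unfold crossArea
    linear_combination (y 0 - x 0) * c1 - (y 1 - x 1) * c0
  have hTu : crossArea x y u ≠ 0 := fun h => hu (mem_line_of_crossArea x y u hxy h)
  have hTv : crossArea x y v ≠ 0 := fun h => hv (mem_line_of_crossArea x y v hxy h)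
  by_cases hop : crossArea u v x * crossArea u v y < 0
  · have hne : crossArea u v x - crossArea u v y ≠ 0 := by
      intro h
      have : crossArea u v x = crossArea u v y := by linarith
      rw [this] at hop
      nlinarith [mul_self_nonneg (crossArea u v y)]
    refine ⟨AffineMap.lineMap x y (crossArea u v x / (crossArea u v x - crossArea u v y)), ?_,
      mem_line_of_crossArea u v _ huv ?_⟩
    · rw [segment_eq_image_lineMap]
      refine ⟨_, ?_, rfl⟩
      rcases lt_or_gt_of_ne hx with hx' | hx'
      · have : 0 < crossArea u v y := by nlinarith
        exact ⟨div_nonneg_of_nonpos hx'.le (by linarith),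
          (div_le_one_of_neg (by linarith)).2 (by linarith)⟩
      · have : crossArea u v y < 0 := by nlinarith
        exact ⟨div_nonneg hx'.le (by linarith), (div_le_one (by linarith)).2 (by linarith)⟩
    · generalize hk : crossArea u v x / (crossArea u v x - crossArea u v y) = k
      rw [div_eq_iff hne] at hk
      have : crossArea u v (AffineMap.lineMap x y k) =
          crossArea u v x - k * (crossArea u v x - crossArea u v y) := by
        simp [crossArea, AffineMap.lineMap_apply]
        ring
      rw [this]
      linarith
  exfalso
  have hS1 : crossArea x u v ≠ 0 := by
    intro h; apply hx; unfold crossArea at *; linear_combination h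
  have hS2 : crossArea x v u ≠ 0 := by
    intro h; apply hx; unfold crossArea at *; linear_combination -h
  have hSS : 0 < crossArea u v x * crossArea u v y :=
    lt_of_le_of_ne (not_lt.1 hop) (mul_ne_zero hx hy).symm
  have hTT : 0 < crossArea x y u * crossArea x y v := by
    have : 0 < r₂ * (crossArea x y u * crossArea x y v) := by
      have e : r₂ * (crossArea x y u * crossArea x y v) = r₁ * crossArea x y u ^ 2 := by
        linear_combination (-crossArea x y u) * hT
      rw [e]; positivity
    exact pos_of_mul_pos_right this hr₂.le
  have i0 : crossArea u v y * x 0 - crossArea u v x * y 0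
      + crossArea x y v * u 0 - crossArea x y u * v 0 = 0 := by
    unfold crossArea; ring
  have i1 : crossArea u v y * x 1 - crossArea u v x * y 1
      + crossArea x y v * u 1 - crossArea x y u * v 1 = 0 := by
    unfold crossArea; ring
  have is : crossArea u v y - crossArea u v x + crossArea x y v - crossArea x y u = 0 := by
    unfold crossArea; ring
  generalize crossArea u v y = A at *
  generalize crossArea u v x = B at *
  generalize crossArea x y v = C at *
  generalize crossArea x y u = D at *
  rcases lt_or_gt_of_ne hx with hB | hB <;> rcases lt_or_gt_of_ne hTu with hD | hD
  · have hA : A < 0 := by nlinarith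
    have hC : C < 0 := by nlinarith
    have := dist_lt_of_cross u v x y (-A) (-C) (-B) (-D) (by linarith) (by linarith)
      (by linarith) (by linarith) (by linarith) (by linarith) (by linarith) hS1
    linarith
  · have hA : A < 0 := by nlinarith
    have hC : 0 < C := by nlinarith
    have := dist_lt_of_cross v u x y (-A) D (-B) C (by linarith) (by linarith)
      (by linarith) (by linarith) (by linarith) (by linarith) (by linarith) hS2
    linarith
  · have hA : 0 < A := by nlinarith
    have hC : C < 0 := by nlinarith
    have := dist_lt_of_cross v u x y A (-D) B (-C) (by linarith) (by linarith)
      (by linarith) (by linarith) (by linarith) (by linarith) (by linarith) hS2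
    linarith
  · have hA : 0 < A := by nlinarith
    have hC : 0 < C := by nlinarith
    have := dist_lt_of_cross u v x y A C B D (by linarith) (by linarith)
      (by linarith) (by linarith) (by linarith) (by linarith) (by linarith) hS1
    linarith
end

section
/- Let p₀, p₁, u, v be points in the Euclidean plane with u ≠ v. Suppose u and v lie strictly on the same side of the affine span of {p₀, p₁}, and suppose the line through u and v (the affine span of {u, v}) is disjoint from the closed segment [p₀, p₁]. Then for every real number κ there is at most one point x in the closed segment [p₀, p₁] satisfying dist(x,u) − dist(x,v) = κ. -/
open scoped RealInnerProductSpace in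
lemma aux_deriv {E : Type*} [NormedAddCommGroup E] [InnerProductSpace ℝ E] (x d u : E) (t : ℝ)
    (h : x + t • d - u ≠ 0) :
    HasDerivAt (fun s : ℝ => ‖x + s • d - u‖) (⟪x + t • d - u, d⟫ / ‖x + t • d - u‖) t := by
  have h1 : HasDerivAt (fun s : ℝ => x + s • d - u) d t := by
    simpa using (((hasDerivAt_id t).smul_const d).const_add x).sub_const u
  have h2 := h1.norm_sq.sqrt (by positivity)
  have hn : ‖x + t • d - u‖ ≠ 0 := by simpa using h
  convert h2 using 1
  · funext s
    rw [Real.sqrt_sq (norm_nonneg _)]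
  · rw [Real.sqrt_sq (norm_nonneg _)]
    field_simp

open scoped RealInnerProductSpace in
lemma aux_alg {E : Type*} [NormedAddCommGroup E] [InnerProductSpace ℝ E] (A B d : E) (a b c : ℝ)
    (ha : 0 < a) (hb : 0 < b) (hA : A ≠ 0) (hB : B ≠ 0) (h : a • A = b • B + c • d)
    (hd : ⟪A, d⟫ / ‖A‖ = ⟪B, d⟫ / ‖B‖) : ‖B‖ • A = ‖A‖ • B := by
  have pA : 0 < ‖A‖ := norm_pos_iff.2 hA
  have pB : 0 < ‖B‖ := norm_pos_iff.2 hB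
  rw [div_eq_div_iff pA.ne' pB.ne'] at hd
  have hWd : ⟪‖B‖ • A - ‖A‖ • B, d⟫ = 0 := by
    rw [inner_sub_left, real_inner_smul_left, real_inner_smul_left]; linarith
  have hs : ⟪‖B‖ • A - ‖A‖ • B, ‖B‖ • A + ‖A‖ • B⟫ = 0 := by
    simp only [inner_sub_left, inner_add_right, real_inner_smul_left, real_inner_smul_right,
      real_inner_comm A B]
    rw [real_inner_self_eq_norm_sq, real_inner_self_eq_norm_sq]
    ring
  have h2 := congrArg (fun z => ⟪‖B‖ • A - ‖A‖ • B, z⟫) h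
  have h3 : ⟪‖B‖ • A - ‖A‖ • B, ‖B‖ • A - ‖A‖ • B⟫ =
    ‖B‖ * ⟪‖B‖ • A - ‖A‖ • B, A⟫ - ‖A‖ * ⟪‖B‖ • A - ‖A‖ • B, B⟫ := by
    rw [inner_sub_right, real_inner_smul_right, real_inner_smul_right]
  simp only [inner_add_right, real_inner_smul_right, hWd] at h2 hs
  generalize hW : ‖B‖ • A - ‖A‖ • B = W at *
  have h4 : (‖B‖ * b + a * ‖A‖) * ⟪W, B⟫ = 0 := by linear_combination a * hs - ‖B‖ * h2
  have h5 : ⟪W, B⟫ = 0 := by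
    rcases mul_eq_zero.1 h4 with h | h
    · have : 0 < ‖B‖ * b + a * ‖A‖ := by positivity
      linarith
    · exact h
  have h6 : ⟪W, A⟫ = 0 := by
    rw [h5] at h2
    have : a * ⟪W, A⟫ = 0 := by linarith
    exact (mul_eq_zero.1 this).resolve_left ha.ne'
  rw [h5, h6] at h3
  have : W = 0 := inner_self_eq_zero (𝕜 := ℝ).1 (by simpa using h3)
  rw [this] at hW
  exact sub_eq_zero.1 hW

/-- Paper's Lemma 3 (t-monotonicity): if both foci `u ≠ v` lie strictly on the same side of
the line through `p₀` and `p₁`, and the line through `u` and `v` misses the closed segment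
`[p₀, p₁]`, then for any constant `κ` there is at most one point of `[p₀, p₁]` whose
difference of distances to `u` and `v` equals `κ`. -/
theorem dist_diff_at_most_one_on_segment
    (p₀ p₁ u v : EuclideanSpace ℝ (Fin 2)) (huv : u ≠ v)
    (hside : AffineSubspace.SSameSide
      (affineSpan ℝ ({p₀, p₁} : Set (EuclideanSpace ℝ (Fin 2)))) u v)
    (hdisj : Disjoint
      (affineSpan ℝ ({u, v} : Set (EuclideanSpace ℝ (Fin 2))) : Set (EuclideanSpace ℝ (Fin 2)))
      (segment ℝ p₀ p₁)) :
    ∀ κ : ℝ, {x | x ∈ segment ℝ p₀ p₁ ∧ dist x u - dist x v = κ}.Subsingleton := by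
  rintro κ x ⟨hx, hxk⟩ y ⟨hy, hyk⟩
  by_contra hxy
  have hsub : segment ℝ p₀ p₁ ⊆ (affineSpan ℝ ({p₀, p₁} : Set (EuclideanSpace ℝ (Fin 2)))) := by
    intro z hz
    rw [segment_eq_image_lineMap] at hz
    obtain ⟨t, -, rfl⟩ := hz
    exact AffineMap.lineMap_mem_affineSpan_pair t p₀ p₁
  obtain ⟨⟨q₁, hq₁, q₂, hq₂, hray⟩, hu, hv⟩ := hside
  have hseg : ∀ t ∈ Set.Icc (0:ℝ) 1, x + t • (y - x) ∈ segment ℝ p₀ p₁ := fun t ht =>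
    (convex_segment p₀ p₁).add_smul_sub_mem hx hy ht
  have hne : ∀ w, w ∉ affineSpan ℝ ({p₀, p₁} : Set (EuclideanSpace ℝ (Fin 2))) →
      ∀ t ∈ Set.Icc (0:ℝ) 1, x + t • (y - x) - w ≠ 0 := by
    intro w hw t ht h0
    rw [sub_eq_zero] at h0
    exact hw (h0 ▸ hsub (hseg t ht))
  have hD : ∀ t ∈ Set.Icc (0:ℝ) 1, HasDerivAt
      (fun s : ℝ => ‖x + s • (y - x) - u‖ - ‖x + s • (y - x) - v‖) _ t := fun t ht =>
    (aux_deriv x (y - x) u t (hne u hu t ht)).sub (aux_deriv x (y - x) v t (hne v hv t ht))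
  obtain ⟨t, ht, h0⟩ := exists_hasDerivAt_eq_zero (zero_lt_one (α := ℝ))
    (fun t ht => (hD t ht).continuousAt.continuousWithinAt)
    (by simp only [zero_smul, add_zero, one_smul, add_sub_cancel, ← dist_eq_norm]
        rw [hxk, hyk]) (fun t ht => hD t (Set.Ioo_subset_Icc_self ht))
  have ht' := Set.Ioo_subset_Icc_self ht
  have hzs := hseg t ht'
  have hA := hne u hu t ht'
  have hB := hne v hv t ht'
  have hz := hsub hzs
  generalize x + t • (y - x) = z at *
  -- same side relation
  have hu1 : u -ᵥ q₁ ≠ 0 := by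
    intro h; exact hu (by rw [vsub_eq_zero_iff_eq.1 h]; exact hq₁)
  have hv1 : v -ᵥ q₂ ≠ 0 := by
    intro h; exact hv (by rw [vsub_eq_zero_iff_eq.1 h]; exact hq₂)
  obtain ⟨a, b, ha, hb, hab⟩ := hray.exists_pos hu1 hv1
  have hx' := hsub hx
  have hy' := hsub hy
  obtain ⟨tx, rfl⟩ := mem_affineSpan_pair_iff_exists_lineMap_eq.1 hx'
  obtain ⟨ty, rfl⟩ := mem_affineSpan_pair_iff_exists_lineMap_eq.1 hy'
  obtain ⟨tz, rfl⟩ := mem_affineSpan_pair_iff_exists_lineMap_eq.1 hz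
  obtain ⟨t1, rfl⟩ := mem_affineSpan_pair_iff_exists_lineMap_eq.1 hq₁
  obtain ⟨t2, rfl⟩ := mem_affineSpan_pair_iff_exists_lineMap_eq.1 hq₂
  have htt : ty - tx ≠ 0 := by
    intro h; exact hxy (by rw [sub_eq_zero.1 h])
  have key := aux_alg _ _ _ a b ((a * (tz - t1) - b * (tz - t2)) / (ty - tx)) ha hb hA hB (by
    simp only [AffineMap.lineMap_apply, vsub_eq_sub, vadd_eq_add] at hab ⊢
    have e : tx • (p₁ - p₀) + p₀ = p₀ + tx • (p₁ - p₀) := add_comm _ _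
    have e2 : ty • (p₁ - p₀) + p₀ - (tx • (p₁ - p₀) + p₀) = (ty - tx) • (p₁ - p₀) := by module
    rw [e2, smul_smul, div_mul_cancel₀ _ htt]
    linear_combination (norm := module) (-1 : ℝ) • hab) (sub_eq_zero.1 h0)
  generalize (AffineMap.lineMap p₀ p₁ tz : EuclideanSpace ℝ (Fin 2)) = z at *
  refine Set.disjoint_left.1 hdisj ?_ hzs
  have hne' : ‖z - v‖ - ‖z - u‖ ≠ 0 := by
    intro h
    rw [sub_eq_zero.1 h] at key
    have := smul_right_injective _ (norm_ne_zero_iff.2 hA) key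
    exact huv (sub_right_injective this)
  have : z = AffineMap.lineMap u v (-‖z - u‖ / (‖z - v‖ - ‖z - u‖)) := by
    apply smul_right_injective _ hne'
    simp only [AffineMap.lineMap_apply, vsub_eq_sub, vadd_eq_add]
    rw [smul_add, smul_smul, mul_div_cancel₀ _ hne']
    linear_combination (norm := module) key
  rw [this]
  exact AffineMap.lineMap_mem_affineSpan_pair _ u v
end

section
/- For real parameters a, b, c, d, e with b ≠ 0 and d ≠ 0, define h_{a,b,c,d,e}(s,t) = Real.sqrt((s+a)² + b²) + Real.sqrt((t+c)² + d²) + e. Let (a,b,c,d,e) and (a',b',c',d',e') be two such parameter tuples with b, b', d, d' all nonzero, let σ : ℝ → ℝ satisfy HasDerivAt σ σ' t₀, and suppose h_{a,b,c,d,e}(σ t, t) = h_{a',b',c',d',e'}(σ t, t) for all t in some neighborhood of t₀. Set D = (σ t₀ + a)/Real.sqrt((σ t₀ + a)² + b²) − (σ t₀ + a')/Real.sqrt((σ t₀ + a')² + b'²). If D ≠ 0, then σ' = ((t₀ + c')/Real.sqrt((t₀ + c')² + d'²) − (t₀ + c)/Real.sqrt((t₀ + c)² + d²)) / D. -/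
/-- The two-corner path-length function `h_{a,b,c,d,e}(s,t) = √((s+a)² + b²) + √((t+c)² + d²) + e`. -/
noncomputable def pathLen (a b c d e : ℝ) (s t : ℝ) : ℝ :=
  Real.sqrt ((s + a) ^ 2 + b ^ 2) + Real.sqrt ((t + c) ^ 2 + d ^ 2) + e

theorem hasDerivAt_leg (f : ℝ → ℝ) (f' t a b : ℝ) (hb : b ≠ 0) (hf : HasDerivAt f f' t) :
    HasDerivAt (fun x => Real.sqrt ((f x + a) ^ 2 + b ^ 2))
      ((f t + a) / Real.sqrt ((f t + a) ^ 2 + b ^ 2) * f') t := by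
  have hpos : 0 < (f t + a) ^ 2 + b ^ 2 := by positivity
  have h := (((hf.add_const a).fun_pow 2).add_const (b ^ 2)).sqrt hpos.ne'
  have hs := (Real.sqrt_pos.mpr hpos).ne'
  convert h using 1
  field_simp
  norm_num
  ring

theorem hasDerivAt_pathLen (a b c d e : ℝ) (hb : b ≠ 0) (hd : d ≠ 0)
    (σ : ℝ → ℝ) (σ' t₀ : ℝ) (hσ : HasDerivAt σ σ' t₀) :
    HasDerivAt (fun t => pathLen a b c d e (σ t) t)
      ((σ t₀ + a) / Real.sqrt ((σ t₀ + a) ^ 2 + b ^ 2) * σ' +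
        (t₀ + c) / Real.sqrt ((t₀ + c) ^ 2 + d ^ 2) * 1) t₀ :=
  ((hasDerivAt_leg σ σ' t₀ a b hb hσ).add
    (hasDerivAt_leg (fun x => x) 1 t₀ c d hd (hasDerivAt_id' t₀))).add_const e

/-- Implicit differentiation of the bisector equation `h_{a,b,c,d,e}(σ t, t) =
h_{a',b',c',d',e'}(σ t, t)` (paper's Lemma 4): the derivative `σ'` of the bisector curve is
`ds/dt = (cos φ_j − cos φ_i)/(cos θ_i − cos θ_j)`. -/
theorem bisector_implicit_deriv
    (a b c d e a' b' c' d' e' : ℝ)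
    (hb : b ≠ 0) (hd : d ≠ 0) (hb' : b' ≠ 0) (hd' : d' ≠ 0)
    (σ : ℝ → ℝ) (σ' t₀ : ℝ) (hσ : HasDerivAt σ σ' t₀)
    (heq : ∀ᶠ t in nhds t₀, pathLen a b c d e (σ t) t = pathLen a' b' c' d' e' (σ t) t)
    (hD : (σ t₀ + a) / Real.sqrt ((σ t₀ + a) ^ 2 + b ^ 2) -
          (σ t₀ + a') / Real.sqrt ((σ t₀ + a') ^ 2 + b' ^ 2) ≠ 0) :
    σ' = ((t₀ + c') / Real.sqrt ((t₀ + c') ^ 2 + d' ^ 2) -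
          (t₀ + c) / Real.sqrt ((t₀ + c) ^ 2 + d ^ 2)) /
         ((σ t₀ + a) / Real.sqrt ((σ t₀ + a) ^ 2 + b ^ 2) -
          (σ t₀ + a') / Real.sqrt ((σ t₀ + a') ^ 2 + b' ^ 2)) := by
  have h1 := hasDerivAt_pathLen a b c d e hb hd σ σ' t₀ hσ
  have h2 := hasDerivAt_pathLen a' b' c' d' e' hb' hd' σ σ' t₀ hσ
  have h3 := h1.unique (h2.congr_of_eventuallyEq heq)
  rw [eq_div_iff hD]
  linarith
end

section
/- For real parameters a, b, c, d, e with b ≠ 0 and d ≠ 0, define h_{a,b,c,d,e}(s,t) = Real.sqrt((s+a)² + b²) + Real.sqrt((t+c)² + d²) + e. Let (a,b,c,d,e) and (a',b',c',d',e') be two such tuples with b, b', d, d' all nonzero, let I ⊆ ℝ be an order-connected set (an interval), and let σ : ℝ → ℝ be continuous on I and differentiable at every point of the interior of I, with h_{a,b,c,d,e}(σ t, t) = h_{a',b',c',d',e'}(σ t, t) for all t ∈ I. Suppose moreover that for all t ∈ I: (t + c)/Real.sqrt((t + c)² + d²) < (t + c')/Real.sqrt((t + c')² + d'²), and (σ t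 + a)/Real.sqrt((σ t + a)² + b²) > (σ t + a')/Real.sqrt((σ t + a')² + b'²). Then σ is strictly monotone increasing on I (StrictMonoOn σ I). -/
/-- Monotonicity conclusion of the paper's Lemma 4: along the bisector curve
`s = σ t` of two path-length functions, if the derivative numerator
`cos φ_j − cos φ_i` and denominator `cos θ_i − cos θ_j` have the indicated constant signs
throughout an interval `I`, then the bisector is strictly increasing on `I`. -/
theorem bisector_strictMonoOn
    (a b c d e a' b' c' d' e' : ℝ)
    (hb : b ≠ 0) (hd : d ≠ 0) (hb' : b' ≠ 0) (hd' : d' ≠ 0)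
    (I : Set ℝ) (hI : I.OrdConnected)
    (σ : ℝ → ℝ) (hcont : ContinuousOn σ I)
    (hdiff : ∀ t ∈ interior I, DifferentiableAt ℝ σ t)
    (heq : ∀ t ∈ I, pathLen a b c d e (σ t) t = pathLen a' b' c' d' e' (σ t) t)
    (hnum : ∀ t ∈ I, (t + c) / Real.sqrt ((t + c) ^ 2 + d ^ 2) <
                     (t + c') / Real.sqrt ((t + c') ^ 2 + d' ^ 2))
    (hden : ∀ t ∈ I, (σ t + a) / Real.sqrt ((σ t + a) ^ 2 + b ^ 2) >
                     (σ t + a') / Real.sqrt ((σ t + a') ^ 2 + b' ^ 2)) :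
    StrictMonoOn σ I := by
  have key : ∀ (p q x : ℝ), q ≠ 0 → HasDerivAt (fun y : ℝ => Real.sqrt ((y + p) ^ 2 + q ^ 2))
      ((x + p) / Real.sqrt ((x + p) ^ 2 + q ^ 2)) x := by
    intro p q x hq
    have hpos : 0 < (x + p) ^ 2 + q ^ 2 := by positivity
    have h1 : HasDerivAt (fun y : ℝ => (y + p) ^ 2 + q ^ 2) (2 * (x + p)) x := by
      have := (((hasDerivAt_id x).add_const p).pow 2).add_const (q ^ 2)
      exact this.congr_deriv (by norm_num)
    have h2 := h1.sqrt hpos.ne'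
    convert h2 using 1
    have := Real.sqrt_pos.mpr hpos
    field_simp
  apply strictMonoOn_of_deriv_pos hI.convex hcont
  intro t ht
  have htI := interior_subset ht
  have hσ := (hdiff t ht).hasDerivAt
  have e1 := (((key a b (σ t) hb).comp t hσ).add (key c d t hd)).sub
    (((key a' b' (σ t) hb').comp t hσ).add (key c' d' t hd'))
  have e2 : HasDerivAt (fun _ : ℝ => e' - e) 0 t := hasDerivAt_const t _
  have e3 := e2.congr_of_eventuallyEq (f₁ := _) (Filter.eventually_of_mem
    (mem_interior_iff_mem_nhds.mp ht) (fun y hy => by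
      have := heq y hy
      unfold pathLen at this
      show (Real.sqrt ((σ y + a) ^ 2 + b ^ 2) + Real.sqrt ((y + c) ^ 2 + d ^ 2)) -
        (Real.sqrt ((σ y + a') ^ 2 + b' ^ 2) + Real.sqrt ((y + c') ^ 2 + d' ^ 2)) = e' - e
      linarith))
  have h := e1.unique e3
  have hn := hnum t htI
  have hdn := hden t htI
  by_contra hneg
  push Not at hneg
  nlinarith [mul_nonneg (sub_nonneg.mpr hdn.le) (neg_nonneg.mpr hneg)]
end
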